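/- Let H be a finite connected regular simple graph and let G be a class 1 nearly regular graph (NRG). Then the palette index of the Cartesian product G □ H equals 2. -/

import Mathlib

open SimpleGraph

/-- A proper edge coloring of `G` (colors in `ℕ`): distinct edges sharing a
vertex receive different colors. -/
def IsProperEdgeColoring {V : Type*} (G : SimpleGraph V) (f : Sym2 V → ℕ) : Prop :=
  ∀ e₁ ∈ G.edgeSet, ∀ e₂ ∈ G.edgeSet, e₁ ≠ e₂ → (∃ v, v ∈ e₁ ∧ v ∈ e₂) → f e₁ ≠ f e₂

/-- The palette of a vertex `v` under an edge coloring `f`: the set of colors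
assigned to the edges incident to `v`. -/
def palette {V : Type*} (G : SimpleGraph V) (f : Sym2 V → ℕ) (v : V) : Set ℕ :=
  {c | ∃ e ∈ G.edgeSet, v ∈ e ∧ f e = c}

/-- The number of distinct palettes of vertices of `G` with respect to `f`. -/
noncomputable def numPalettes {V : Type*} (G : SimpleGraph V) (f : Sym2 V → ℕ) : ℕ :=
  (Set.range (palette G f)).ncard

/-- The palette index `š(G)`: the minimum number of distinct vertex palettes
over all proper edge colorings of `G`. -/
noncomputable def paletteIndex {V : Type*} (G : SimpleGraph V) : ℕ :=
  sInf {n | ∃ f, IsProperEdgeColoring G f ∧ numPalettes G f = n}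

/-- The chromatic index `χ'(G)`: the minimum `n` such that `G` has a proper
edge coloring with colors from `{0, …, n-1}`. -/
noncomputable def chromIndex {V : Type*} (G : SimpleGraph V) : ℕ :=
  sInf {n | ∃ f, IsProperEdgeColoring G f ∧ ∀ e ∈ G.edgeSet, f e < n}

/-- The degree of a vertex. -/
noncomputable def vertDegree {V : Type*} (G : SimpleGraph V) (v : V) : ℕ :=
  (G.neighborSet v).ncard

/-- The maximum degree `Δ(G)`. -/
noncomputable def maxDeg {V : Type*} (G : SimpleGraph V) : ℕ :=
  sSup (Set.range (vertDegree G))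

/-- `G` is class 1 if `χ'(G) = Δ(G)`. -/
def IsClass1 {V : Type*} (G : SimpleGraph V) : Prop := chromIndex G = maxDeg G

/-- `G` is `r`-regular. -/
def IsRegularDeg {V : Type*} (G : SimpleGraph V) (r : ℕ) : Prop :=
  ∀ v, vertDegree G v = r

/-- A perfect matching: a set `M` of edges of `G` such that every vertex is
incident to exactly one edge of `M`. -/
def IsPerfectMatchingSet {V : Type*} (G : SimpleGraph V) (M : Set (Sym2 V)) : Prop :=
  M ⊆ G.edgeSet ∧ ∀ v : V, ∃! e, e ∈ M ∧ v ∈ e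

/-- `G` is a class 1 nearly regular graph (NRG): `G = G' − X` for some finite
connected `r`-regular class 1 graph `G'` with at least one edge, a perfect
matching `M` of `G'` with `G' − M` class 1, and `∅ ≠ X ⊊ M`. -/
def IsNRG {V : Type*} (G : SimpleGraph V) : Prop :=
  ∃ (G' : SimpleGraph V) (r : ℕ) (M X : Set (Sym2 V)),
    G'.Connected ∧ IsRegularDeg G' r ∧ IsClass1 G' ∧ G'.edgeSet.Nonempty ∧
    IsPerfectMatchingSet G' M ∧ IsClass1 (G'.deleteEdges M) ∧
    X.Nonempty ∧ X ⊂ M ∧ G = G'.deleteEdges X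


section Aux

open Finset

open scoped Classical in
lemma comp_sum {V : Type*} [Fintype V] (D : SimpleGraph V) (C : D.ConnectedComponent) :
    2 * #{v : V | v ∈ C.supp} ≤ ∑ v : V with v ∈ C.supp, D.degree v + 2 := by
  have h1 := C.connected_toSimpleGraph.card_vert_le_card_edgeSet_add_one
  have h2 := C.toSimpleGraph.sum_degrees_eq_twice_card_edges
  have h3 : ∀ v : C, C.toSimpleGraph.degree v = D.degree v := by
    intro v
    suffices key : D.neighborSet v ⊆ C.supp by
      have := D.degree_induce_of_neighborSet_subset (s := C.supp) (v := v) key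
      rw [← this, ← SimpleGraph.card_neighborSet_eq_degree, ← SimpleGraph.card_neighborSet_eq_degree]
      exact Fintype.card_congr (Equiv.refl _)
    intro w hw
    have hv : (v : V) ∈ C.supp := v.2
    rw [SimpleGraph.ConnectedComponent.mem_supp_iff] at hv ⊢
    rw [← hv]
    exact (SimpleGraph.ConnectedComponent.connectedComponentMk_eq_of_adj hw).symm
  have h4 : ∑ v : C, C.toSimpleGraph.degree v = ∑ v : V with v ∈ C.supp, D.degree v := by
    rw [Finset.sum_congr rfl (fun v _ => h3 v)]
    exact (Finset.sum_subtype (p := fun v => v ∈ C.supp) _ (by simp) (fun v => D.degree v)).symm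
  have h5 : Nat.card C = #{v : V | v ∈ C.supp} := by
    rw [Nat.card_eq_fintype_card]
    exact Fintype.card_of_subtype _ (fun x => by simp; rfl)
  have h6 : Nat.card C.toSimpleGraph.edgeSet = #C.toSimpleGraph.edgeFinset := by
    rw [Nat.card_eq_fintype_card, SimpleGraph.edgeFinset_card]
  omega

lemma palette_eq_image {V : Type*} (G : SimpleGraph V) (f : Sym2 V → ℕ) (v : V) :
    palette G f v = (fun w => f s(v, w)) '' G.neighborSet v := by
  ext c
  constructor
  · rintro ⟨e, he, hv, rfl⟩
    obtain ⟨w, rfl⟩ := hv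
    exact ⟨w, he, rfl⟩
  · rintro ⟨w, hw, rfl⟩
    exact ⟨s(v, w), hw, by simp, rfl⟩

lemma proper_injOn {V : Type*} {G : SimpleGraph V} {f : Sym2 V → ℕ}
    (hf : IsProperEdgeColoring G f) (v : V) :
    Set.InjOn (fun w => f s(v, w)) (G.neighborSet v) := by
  intro w hw w' hw' h
  by_contra hne
  refine hf s(v, w) hw s(v, w') hw' ?_ ⟨v, by simp, by simp⟩ h
  intro h'
  exact hne (Sym2.congr_right.mp h')

lemma palette_ncard {V : Type*} {G : SimpleGraph V} {f : Sym2 V → ℕ}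
    (hf : IsProperEdgeColoring G f) (v : V) :
    (palette G f v).ncard = vertDegree G v := by
  rw [palette_eq_image, (proper_injOn hf v).ncard_image]
  rfl

/-- Sufficient condition for properness in terms of neighbours. -/
lemma proper_of_injOn {V : Type*} {G : SimpleGraph V} {f : Sym2 V → ℕ}
    (h : ∀ v w w', G.Adj v w → G.Adj v w' → f s(v, w) = f s(v, w') → w = w') :
    IsProperEdgeColoring G f := by
  rintro e₁ h₁ e₂ h₂ hne ⟨v, hv1, hv2⟩ he
  obtain ⟨w, rfl⟩ := hv1
  obtain ⟨w', rfl⟩ := hv2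
  exact hne (by rw [h v w w' h₁ h₂ he])

/-- The subgraph of edges of colors `a` or `b`. -/
def kempe {V : Type*} (G : SimpleGraph V) (c : Sym2 V → ℕ) (a b : ℕ) : SimpleGraph V where
  Adj x y := G.Adj x y ∧ (c s(x, y) = a ∨ c s(x, y) = b)
  symm := ⟨by
    rintro x y ⟨h, h'⟩
    rw [Sym2.eq_swap]
    exact ⟨h.symm, h'⟩⟩
  loopless := ⟨fun x h => G.loopless.irrefl x h.1⟩

open scoped Classical in
lemma kempe_degree {V : Type*} [Fintype V] {G : SimpleGraph V} {c : Sym2 V → ℕ}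
    (hc : IsProperEdgeColoring G c) {a b : ℕ} (hab : a ≠ b) (u : V) (A : Finset ℕ)
    (hA : ∀ x ∈ A, x ∉ palette G c u) :
    (kempe G c a b).degree u + ((if a ∈ A then 1 else 0) + (if b ∈ A then 1 else 0)) ≤ 2 := by
  have h1 : (kempe G c a b).degree u = #(((kempe G c a b).neighborFinset u).image
      (fun w => c s(u, w))) := by
    rw [Finset.card_image_of_injOn, SimpleGraph.card_neighborFinset_eq_degree]
    intro w hw w' hw' h
    have hw1 : (kempe G c a b).Adj u w := by simpa using hw
    have hw2 : (kempe G c a b).Adj u w' := by simpa using hw'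
    exact proper_injOn hc u hw1.1 hw2.1 h
  have h2 : ((kempe G c a b).neighborFinset u).image (fun w => c s(u, w)) ⊆
      ({a, b} : Finset ℕ).filter (fun x => x ∉ A) := by
    intro x hx
    simp only [Finset.mem_image, SimpleGraph.mem_neighborFinset] at hx
    obtain ⟨w, hw, rfl⟩ := hx
    simp only [Finset.mem_filter, Finset.mem_insert, Finset.mem_singleton]
    refine ⟨hw.2, fun h => hA _ h ?_⟩
    rw [palette_eq_image]
    exact ⟨w, hw.1, rfl⟩
  have h3 := Finset.card_le_card h2
  rw [← h1] at h3
  have h4 : #(({a, b} : Finset ℕ).filter (fun x => x ∉ A)) +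
      ((if a ∈ A then 1 else 0) + (if b ∈ A then 1 else 0)) = 2 := by
    rw [Finset.card_filter, Finset.sum_pair hab]
    split_ifs <;> simp_all
  omega

open scoped Classical in
lemma kempe_count {V : Type*} [Fintype V] {G : SimpleGraph V} {c : Sym2 V → ℕ}
    (hc : IsProperEdgeColoring G c) {a b : ℕ} (hab : a ≠ b) (M : V → Finset ℕ)
    (hM : ∀ u, ∀ x ∈ M u, x ∉ palette G c u) (C : (kempe G c a b).ConnectedComponent) :
    #{u : V | u ∈ C.supp ∧ a ∈ M u} + #{u : V | u ∈ C.supp ∧ b ∈ M u} ≤ 2 := by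
  have h1 := comp_sum _ C
  have h2 : ∑ v : V with v ∈ C.supp, ((kempe G c a b).degree v +
      ((if a ∈ M v then 1 else 0) + (if b ∈ M v then 1 else 0))) ≤
      ∑ v : V with v ∈ C.supp, 2 :=
    Finset.sum_le_sum fun v _ => kempe_degree hc hab v (M v) (hM v)
  rw [Finset.sum_add_distrib, Finset.sum_add_distrib, ← Finset.card_filter, ← Finset.card_filter,
    Finset.filter_filter, Finset.filter_filter, Finset.sum_const, smul_eq_mul] at h2
  omega

open scoped Classical in
/-- Swap colors `a` and `b` on a Kempe component. -/
noncomputable def kswap {V : Type*} (G : SimpleGraph V) (c : Sym2 V → ℕ) (a b : ℕ)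
    (C : (kempe G c a b).ConnectedComponent) (e : Sym2 V) : ℕ :=
  if ∃ x ∈ e, x ∈ C.supp then Equiv.swap a b (c e) else c e

open scoped Classical in
lemma kswap_apply {V : Type*} {G : SimpleGraph V} {c : Sym2 V → ℕ} {a b : ℕ}
    (C : (kempe G c a b).ConnectedComponent) {v w : V} (h : G.Adj v w) :
    kswap G c a b C s(v, w) =
      if v ∈ C.supp then Equiv.swap a b (c s(v, w)) else c s(v, w) := by
  unfold kswap
  by_cases hv : v ∈ C.supp
  · rw [if_pos hv, if_pos ⟨v, by simp, hv⟩]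
  · rw [if_neg hv]
    split_ifs with hx
    · obtain ⟨x, hx, hxC⟩ := hx
      rw [Sym2.mem_iff] at hx
      rcases hx with rfl | rfl
      · exact absurd hxC hv
      · apply Equiv.swap_apply_of_ne_of_ne <;>
        · intro hcol
          apply hv
          have hadj : (kempe G c a b).Adj v x := ⟨h, by simp [hcol]⟩
          rw [SimpleGraph.ConnectedComponent.mem_supp_iff] at hxC ⊢
          rw [← hxC]
          exact SimpleGraph.ConnectedComponent.connectedComponentMk_eq_of_adj hadj
    · rfl

lemma kswap_proper {V : Type*} {G : SimpleGraph V} {c : Sym2 V → ℕ} {a b : ℕ}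
    (hc : IsProperEdgeColoring G c)
    (C : (kempe G c a b).ConnectedComponent) :
    IsProperEdgeColoring G (kswap G c a b C) := by
  apply proper_of_injOn
  intro v w w' h h' he
  rw [kswap_apply C h, kswap_apply C h'] at he
  apply proper_injOn hc v h h'
  split_ifs at he
  · exact (Equiv.swap a b).injective he
  · exact he

open scoped Classical in
lemma kswap_palette {V : Type*} {G : SimpleGraph V} {c : Sym2 V → ℕ} {a b : ℕ}
    (C : (kempe G c a b).ConnectedComponent) (v : V) :
    palette G (kswap G c a b C) v =
      if v ∈ C.supp then Equiv.swap a b '' palette G c v else palette G c v := by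
  rw [palette_eq_image, palette_eq_image]
  split_ifs with hv
  · rw [Set.image_image]
    exact Set.image_congr fun w hw => by rw [kswap_apply C hw, if_pos hv]
  · exact Set.image_congr fun w hw => by rw [kswap_apply C hw, if_neg hv]

/-- `c'` arises from `c` by recoloring only inside the color set `K`. -/
def Agree {V : Type*} (K : Finset ℕ) (c c' : Sym2 V → ℕ) : Prop :=
  ∀ e, (c e ∉ K → c' e = c e) ∧ (c e ∈ K → c' e ∈ K)

lemma kswap_agree {V : Type*} {G : SimpleGraph V} {c : Sym2 V → ℕ} {a b : ℕ} {K : Finset ℕ}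
    (ha : a ∈ K) (hb : b ∈ K) (C : (kempe G c a b).ConnectedComponent) :
    Agree K c (kswap G c a b C) := by
  intro e
  unfold kswap
  split_ifs
  · constructor
    · intro h
      exact Equiv.swap_apply_of_ne_of_ne (fun h' => h (h' ▸ ha)) (fun h' => h (h' ▸ hb))
    · intro h
      rw [Equiv.swap_apply_def]
      split_ifs <;> assumption
  · exact ⟨fun _ => rfl, fun h => h⟩

lemma Agree.trans {V : Type*} {K : Finset ℕ} {c c' c'' : Sym2 V → ℕ}
    (h : Agree K c c') (h' : Agree K c' c'') : Agree K c c'' := by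
  intro e
  have h1 := h e
  have h2 := h' e
  constructor
  · intro he
    rw [h2.1 (by rw [h1.1 he]; exact he), h1.1 he]
  · intro he
    exact h2.2 (h1.2 he)

open scoped Classical in
/-- Number of vertices whose list contains `a`. -/
noncomputable def cnt {V : Type*} [Fintype V] (M : V → Finset ℕ) (a : ℕ) : ℕ := #{u : V | a ∈ M u}

open scoped Classical in
lemma cnt_split {V : Type*} [Fintype V] (M : V → Finset ℕ) (a : ℕ) (S : Set V) :
    cnt M a = #{u : V | u ∈ S ∧ a ∈ M u} + #{u : V | u ∉ S ∧ a ∈ M u} := by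
  unfold cnt
  rw [← Finset.card_filter_add_card_filter_not (s := {u : V | a ∈ M u}) (fun u => u ∈ S),
    Finset.filter_filter, Finset.filter_filter]
  simp only [and_comm]

open scoped Classical in
lemma exists_comp {V : Type*} [Fintype V] (D : SimpleGraph V) (M : V → Finset ℕ) {a b : ℕ}
    (h : cnt M b < cnt M a) : ∃ C : D.ConnectedComponent,
      #{u : V | u ∈ C.supp ∧ b ∈ M u} < #{u : V | u ∈ C.supp ∧ a ∈ M u} := by
  by_contra! hcon
  have : Fintype D.ConnectedComponent := Fintype.ofFinite _
  have key : ∀ x, cnt M x = ∑ C : D.ConnectedComponent, #{u : V | u ∈ C.supp ∧ x ∈ M u} := by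
    intro x
    unfold cnt
    rw [Finset.card_eq_sum_card_fiberwise (f := D.connectedComponentMk) (t := Finset.univ)
      (by intro u _; simp)]
    refine Finset.sum_congr rfl fun C _ => ?_
    rw [Finset.filter_filter]
    simp only [SimpleGraph.ConnectedComponent.mem_supp_iff, and_comm]
  rw [key a, key b] at h
  exact absurd (Finset.sum_le_sum (s := Finset.univ) fun C _ => hcon C) (by omega)

open scoped Classical in
lemma balance {V : Type*} [Fintype V] {G : SimpleGraph V} (K : Finset ℕ) :
    ∀ (n : ℕ) (c : Sym2 V → ℕ) (M : V → Finset ℕ), IsProperEdgeColoring G c →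
    (∀ u, ∀ x ∈ M u, x ∈ K ∧ x ∉ palette G c u) → ∑ a ∈ K, cnt M a ^ 2 = n →
    ∃ (c' : Sym2 V → ℕ) (M' : V → Finset ℕ), IsProperEdgeColoring G c' ∧
      (∀ u, ∀ x ∈ M' u, x ∈ K ∧ x ∉ palette G c' u) ∧ Agree K c c' ∧
      (∀ u, #(M' u) = #(M u)) ∧ ∀ a ∈ K, ∀ b ∈ K, cnt M' a ≤ cnt M' b + 2 := by
  intro n
  induction n using Nat.strong_induction_on with
  | _ n ih =>
  intro c M hc hM hn
  by_cases hbal : ∀ a ∈ K, ∀ b ∈ K, cnt M a ≤ cnt M b + 2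
  · exact ⟨c, M, hc, hM, fun e => ⟨fun _ => rfl, fun h => h⟩, fun _ => rfl, hbal⟩
  push Not at hbal
  obtain ⟨a, ha, b, hb, hlt⟩ := hbal
  have hab : a ≠ b := by rintro rfl; omega
  obtain ⟨C, hC⟩ := exists_comp (kempe G c a b) M (show cnt M b < cnt M a by omega)
  have hcount := kempe_count hc hab M (fun u x hx => (hM u x hx).2) C
  set M' : V → Finset ℕ := fun u =>
    if u ∈ C.supp then (M u).image (Equiv.swap a b) else M u with hM'
  have hmem : ∀ u i, i ∈ M' u ↔ if u ∈ C.supp then Equiv.swap a b i ∈ M u else i ∈ M u := by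
    intro u i
    simp only [hM']
    split_ifs
    · rw [Finset.mem_image]
      constructor
      · rintro ⟨x, hx, rfl⟩
        simpa using hx
      · intro h
        exact ⟨_, h, by simp⟩
    · rfl
  have hcard : ∀ u, #(M' u) = #(M u) := by
    intro u
    simp only [hM']
    split_ifs
    · exact Finset.card_image_of_injective _ (Equiv.swap a b).injective
    · rfl
  have hvalid : ∀ u, ∀ x ∈ M' u, x ∈ K ∧ x ∉ palette G (kswap G c a b C) u := by
    intro u x hx
    rw [hmem] at hx
    rw [kswap_palette]
    split_ifs at hx ⊢ with hu
    · obtain ⟨h1, h2⟩ := hM u _ hx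
      constructor
      · rw [Equiv.swap_apply_def] at h1
        split_ifs at h1 with h3 h4
        · rwa [h3]
        · rwa [h4]
        · exact h1
      · rintro ⟨y, hy, rfl⟩
        apply h2
        simpa using hy
    · exact hM u x hx
  have hother : ∀ i, i ≠ a → i ≠ b → cnt M' i = cnt M i := by
    intro i hia hib
    unfold cnt
    congr 1
    ext u
    simp [hmem, Equiv.swap_apply_of_ne_of_ne hia hib]
  have hA : cnt M' a = #{u : V | u ∈ C.supp ∧ b ∈ M u} + #{u : V | u ∉ C.supp ∧ a ∈ M u} := by
    rw [cnt_split M' a C.supp]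
    congr 2
    · ext u
      simp only [Finset.mem_filter, hmem, Equiv.swap_apply_left]
      by_cases hu : u ∈ C.supp <;> simp [hu]
    · ext u
      simp only [Finset.mem_filter, hmem]
      by_cases hu : u ∈ C.supp <;> simp [hu]
  have hB : cnt M' b = #{u : V | u ∈ C.supp ∧ a ∈ M u} + #{u : V | u ∉ C.supp ∧ b ∈ M u} := by
    rw [cnt_split M' b C.supp]
    congr 2
    · ext u
      simp only [Finset.mem_filter, hmem, Equiv.swap_apply_right]
      by_cases hu : u ∈ C.supp <;> simp [hu]
    · ext u
      simp only [Finset.mem_filter, hmem]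
      by_cases hu : u ∈ C.supp <;> simp [hu]
  have hA0 : cnt M a = #{u : V | u ∈ C.supp ∧ a ∈ M u} +
      #{u : V | u ∉ C.supp ∧ a ∈ M u} := by
    rw [cnt_split M a C.supp]
    congr!
  have hB0 : cnt M b = #{u : V | u ∈ C.supp ∧ b ∈ M u} +
      #{u : V | u ∉ C.supp ∧ b ∈ M u} := by
    rw [cnt_split M b C.supp]
    congr!
  have hsum : ∀ L : V → Finset ℕ, ∑ i ∈ K, cnt L i ^ 2 =
      cnt L a ^ 2 + (cnt L b ^ 2 + ∑ i ∈ (K.erase a).erase b, cnt L i ^ 2) := by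
    intro L
    rw [Finset.add_sum_erase (K.erase a) (fun i => cnt L i ^ 2) (by simp [hb, hab.symm]),
      Finset.add_sum_erase K (fun i => cnt L i ^ 2) ha]
  have hrest : ∑ i ∈ (K.erase a).erase b, cnt M' i ^ 2 =
      ∑ i ∈ (K.erase a).erase b, cnt M i ^ 2 := by
    refine Finset.sum_congr rfl fun i hi => ?_
    simp only [Finset.mem_erase] at hi
    rw [hother i hi.2.1 hi.1]
  have hdec : ∑ i ∈ K, cnt M' i ^ 2 < n := by
    rw [← hn, hsum M', hsum M, hrest, hA, hB, hA0, hB0]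
    rw [hA0, hB0] at hlt
    generalize #{u : V | u ∈ C.supp ∧ a ∈ M u} = p at *
    generalize #{u : V | u ∈ C.supp ∧ b ∈ M u} = q at *
    generalize #{u : V | u ∉ C.supp ∧ a ∈ M u} = s at *
    generalize #{u : V | u ∉ C.supp ∧ b ∈ M u} = t at *
    obtain ⟨k, rfl⟩ : ∃ k, p = q + 1 + k := ⟨p - q - 1, by omega⟩
    obtain ⟨l, rfl⟩ : ∃ l, s = t + 1 + l := ⟨s - t - 1, by omega⟩
    nlinarith [Nat.zero_le (k * l)]
  obtain ⟨c', M'', h1, h2, h3, h4, h5⟩ := ih _ hdec _ M' (kswap_proper hc C) hvalid rfl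
  exact ⟨c', M'', h1, h2, (kswap_agree ha hb C).trans h3, fun u => (h4 u).trans (hcard u), h5⟩

open scoped Classical in
lemma sum_cnt {V : Type*} [Fintype V] (K : Finset ℕ) (M : V → Finset ℕ)
    (hM : ∀ u, ∀ x ∈ M u, x ∈ K) : ∑ a ∈ K, cnt M a = ∑ u, #(M u) := by
  unfold cnt
  simp only [Finset.card_filter]
  rw [Finset.sum_comm]
  refine Finset.sum_congr rfl fun u _ => ?_
  rw [← Finset.card_filter]
  congr 1
  ext x
  simp only [Finset.mem_filter]
  exact ⟨fun h => h.2, fun h => ⟨hM u x h, h⟩⟩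

open scoped Classical in
lemma exists_cnt_one {V : Type*} [Fintype V] (K : Finset ℕ) (M : V → Finset ℕ)
    (hM : ∀ u, ∀ x ∈ M u, x ∈ K) (N : Finset V) (u0 : V) (hu0 : u0 ∈ N) (hNK : #N ≤ #K)
    (hcard : ∀ u, #(M u) = if u = u0 then 1 else if u ∈ N then 2 else 0)
    (hbal : ∀ a ∈ K, ∀ b ∈ K, cnt M a ≤ cnt M b + 2) : ∃ i ∈ K, cnt M i = 1 := by
  by_contra! hcon
  have h1 : ∑ a ∈ K, cnt M a + 1 = 2 * #N := by
    rw [sum_cnt K M hM]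
    have : ∑ u, #(M u) + ∑ u : V, (if u = u0 then 1 else 0) =
        ∑ u : V, if u ∈ N then 2 else 0 := by
      rw [← Finset.sum_add_distrib]
      refine Finset.sum_congr rfl fun u _ => ?_
      rw [hcard]
      by_cases h : u = u0
      · subst h
        simp [hu0]
      · simp [h]
    rw [Finset.sum_ite_eq' Finset.univ u0, if_pos (Finset.mem_univ _)] at this
    rw [this, ← Finset.sum_filter, Finset.sum_const, smul_eq_mul, mul_comm]
    simp
  obtain ⟨i, hi, hi2⟩ : ∃ i ∈ K, cnt M i < 2 := by
    apply Finset.exists_lt_of_sum_lt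
    rw [Finset.sum_const, smul_eq_mul]
    omega
  have h2 : 2 ∣ ∑ a ∈ K, cnt M a := by
    apply Finset.dvd_sum
    intro a ha
    have := hbal a ha i hi
    have := hcon a ha
    have := hcon i hi
    have : cnt M a = 0 ∨ cnt M a = 2 := by omega
    rcases this with h | h <;> simp [h]
  omega

open scoped Classical in
lemma sdr {V : Type*} [Fintype V] {G : SimpleGraph V} :
    ∀ (n : ℕ) (K : Finset ℕ) (c : Sym2 V → ℕ) (M : V → Finset ℕ) (N : Finset V) (u0 : V),
    #N = n → IsProperEdgeColoring G c →
    (∀ u, ∀ x ∈ M u, x ∈ K ∧ x ∉ palette G c u) → #N ≤ #K → u0 ∈ N →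
    (∀ u, #(M u) = if u = u0 then 1 else if u ∈ N then 2 else 0) →
    ∃ (c' : Sym2 V → ℕ) (g : V → ℕ), IsProperEdgeColoring G c' ∧ Agree K c c' ∧
      (∀ u ∈ N, g u ∈ K ∧ g u ∉ palette G c' u) ∧ Set.InjOn g N := by
  intro n
  induction n with
  | zero =>
    intro K c M N u0 hN _ _ _ hu0
    rw [Finset.card_eq_zero] at hN
    simp [hN] at hu0
  | succ n ih =>
  intro K c M N u0 hN hc hM hNK hu0 hcard
  obtain ⟨c1, M1, hc1, hM1, hag1, hcard1, hbal⟩ := balance K _ c M hc hM rfl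
  replace hcard1 : ∀ u, #(M1 u) = if u = u0 then 1 else if u ∈ N then 2 else 0 :=
    fun u => (hcard1 u).trans (hcard u)
  obtain ⟨i, hiK, hi⟩ := exists_cnt_one K M1 (fun u x hx => (hM1 u x hx).1) N u0 hu0 hNK hcard1 hbal
  obtain ⟨u1, hu1⟩ := Finset.card_eq_one.mp hi
  have hiff : ∀ u, i ∈ M1 u ↔ u = u1 := by
    intro u
    have := congrArg (fun s => u ∈ s) hu1
    simpa using this
  have hi1 : i ∈ M1 u1 := (hiff u1).2 rfl
  have hu1N : u1 ∈ N := by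
    by_contra h
    have h2 : u1 ≠ u0 := by rintro rfl; exact h hu0
    have := hcard1 u1
    rw [if_neg h2, if_neg h, Finset.card_eq_zero] at this
    simp [this] at hi1
  by_cases hemp : N.erase u1 = ∅
  · have hN1 : ∀ u ∈ N, u = u1 := by
      intro u hu
      by_contra h
      have : u ∈ N.erase u1 := by simp [h, hu]
      simp [hemp] at this
    refine ⟨c1, fun _ => i, hc1, hag1, ?_, ?_⟩
    · intro u hu
      rw [hN1 u hu]
      exact hM1 _ _ hi1
    · intro u hu v hv _
      rw [hN1 u hu, hN1 v hv]
  obtain ⟨u2, hu2, M', hsub, hcard'⟩ : ∃ u2 ∈ N.erase u1, ∃ M' : V → Finset ℕ,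
      (∀ u, M' u ⊆ M1 u) ∧
      ∀ u, #(M' u) = if u = u2 then 1 else if u ∈ N.erase u1 then 2 else 0 := by
    by_cases h01 : u1 = u0
    · obtain ⟨u2, hu2⟩ := Finset.nonempty_iff_ne_empty.mpr hemp
      have hu2' := hu2
      rw [Finset.mem_erase] at hu2'
      have h3 := hcard1 u2
      rw [if_neg (h01 ▸ hu2'.1), if_pos hu2'.2] at h3
      obtain ⟨x, hx⟩ : (M1 u2).Nonempty := Finset.card_pos.mp (by omega)
      refine ⟨u2, hu2, fun u => if u = u2 then {x} else if u = u1 then ∅ else M1 u, ?_, ?_⟩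
      · intro u
        dsimp only
        split_ifs with h h'
        · subst h; simpa using hx
        · simp
        · simp
      · intro u
        dsimp only
        split_ifs with h h' h'' h''
        · simp
        · simp [h'] at h''
        · simp
        · rw [hcard1, if_neg (h01 ▸ h'), if_pos (Finset.mem_of_mem_erase h'')]
        · rw [hcard1, if_neg (h01 ▸ h'), if_neg]
          simpa [h'] using h''
    · refine ⟨u0, by simp [hu0, Ne.symm h01], fun u => if u = u1 then ∅ else M1 u, ?_, ?_⟩
      · intro u
        dsimp only
        split_ifs <;> simp
      · intro u
        dsimp only
        by_cases h : u = u1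
        · subst h
          simp [h01]
        · simp [h, hcard1]
  have hKi : #(K.erase i) + 1 = #K := Finset.card_erase_add_one hiK
  have hNi : #(N.erase u1) + 1 = #N := Finset.card_erase_add_one hu1N
  obtain ⟨c2, g2, hc2, hag2, hg2, hinj2⟩ := ih (K.erase i) c1 M' (N.erase u1) u2 (by omega) hc1
    (by
      intro u x hx
      have hx1 := hsub u hx
      refine ⟨?_, (hM1 u x hx1).2⟩
      rw [Finset.mem_erase]
      refine ⟨?_, (hM1 u x hx1).1⟩
      rintro rfl
      have h := (hiff u).1 hx1
      subst h
      have h4 := hcard' u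
      have h5 : u ≠ u2 := by rintro rfl; simp at hu2
      rw [if_neg h5, if_neg (by simp), Finset.card_eq_zero] at h4
      simp [h4] at hx) (by omega) hu2 hcard'
  refine ⟨c2, fun u => if u = u1 then i else g2 u, hc2, hag1.trans ?_, ?_, ?_⟩
  · intro e
    have h := hag2 e
    simp only [Finset.mem_erase] at h
    constructor
    · intro he
      exact h.1 (fun h' => he h'.2)
    · intro he
      by_cases hei : c1 e = i
      · rw [h.1 (fun h' => h'.1 hei)]
        exact he
      · exact (h.2 ⟨hei, he⟩).2
  · intro u hu
    dsimp only
    split_ifs with h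
    · subst h
      refine ⟨hiK, ?_⟩
      rintro ⟨e, heG, hue, hei⟩
      have h := hag2 e
      by_cases hmem : c1 e ∈ K.erase i
      · have := h.2 hmem
        simp [hei] at this
      · rw [h.1 hmem] at hei
        exact (hM1 u i hi1).2 ⟨e, heG, hue, hei⟩
    · have := hg2 u (by simp [h, hu])
      exact ⟨Finset.mem_of_mem_erase this.1, this.2⟩
  · intro u hu v hv huv
    dsimp only at huv
    have hne : ∀ w ∈ N, w ≠ u1 → g2 w ≠ i := by
      intro w hw hw1
      exact Finset.ne_of_mem_erase (hg2 w (by simp [hw, hw1])).1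
    split_ifs at huv with h1 h2 h2
    · rw [h1, h2]
    · exact absurd huv.symm (hne v hv h2)
    · exact absurd huv (hne u hu h1)
    · exact hinj2 (by simpa [h1] using hu) (by simpa [h2] using hv) huv

/-- The spanning subgraph of edges inside `S`. -/
def restr {W : Type*} (H : SimpleGraph W) (S : Finset W) : SimpleGraph W where
  Adj x y := H.Adj x y ∧ x ∈ S ∧ y ∈ S
  symm := ⟨fun _ _ h => ⟨h.1.symm, h.2.2, h.2.1⟩⟩
  loopless := ⟨fun x h => H.loopless.irrefl x h.1⟩

open scoped Classical in
lemma miss_card {W : Type*} [Fintype W] {G : SimpleGraph W} {c : Sym2 W → ℕ}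
    (hc : IsProperEdgeColoring G c) (u : W) (d : ℕ) (hd : vertDegree G u + 1 ≤ d) :
    2 ≤ #((Finset.range (d + 1)).filter (fun x => x ∉ palette G c u)) := by
  have hfin : (palette G c u).Finite := by
    rw [palette_eq_image]
    exact Set.toFinite _
  have h1 : #((Finset.range (d + 1)).filter (fun x => x ∈ palette G c u)) ≤ vertDegree G u := by
    rw [← palette_ncard hc u, ← Set.ncard_coe_finset]
    apply Set.ncard_le_ncard _ hfin
    intro x hx
    simp at hx
    exact hx.2
  have h2 := Finset.card_filter_add_card_filter_not (s := Finset.range (d + 1))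
    (fun x => x ∈ palette G c u)
  rw [Finset.card_range] at h2
  omega

open scoped Classical in
lemma vizing_aux {W : Type*} [Fintype W] (H : SimpleGraph W) (d : ℕ)
    (hd : ∀ v, vertDegree H v ≤ d) (S : Finset W) :
    ∃ c : Sym2 W → ℕ, IsProperEdgeColoring (restr H S) c ∧ ∀ e, c e < d + 1 := by
  induction S using Finset.induction_on with
  | empty =>
    refine ⟨fun _ => 0, ?_, fun _ => Nat.succ_pos _⟩
    apply proper_of_injOn
    rintro v w w' ⟨_, h, _⟩
    simp at h
  | insert v S hvS ih =>
  obtain ⟨c, hc, hcd⟩ := ih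
  set N : Finset W := {u | H.Adj v u ∧ u ∈ S} with hN
  have hmemN : ∀ u, u ∈ N ↔ H.Adj v u ∧ u ∈ S := by intro u; simp [hN]
  obtain ⟨c', g, hc', hcd', hg, hinj⟩ : ∃ (c' : Sym2 W → ℕ) (g : W → ℕ),
      IsProperEdgeColoring (restr H S) c' ∧ (∀ e, c' e < d + 1) ∧
      (∀ u ∈ N, g u < d + 1 ∧ g u ∉ palette (restr H S) c' u) ∧ Set.InjOn g N := by
    by_cases hemp : N = ∅
    · exact ⟨c, fun _ => 0, hc, hcd, by simp [hemp], by simp [hemp]⟩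
    obtain ⟨u0, hu0⟩ := Finset.nonempty_iff_ne_empty.mpr hemp
    have hdeg : ∀ u ∈ N, vertDegree (restr H S) u + 1 ≤ d := by
      intro u hu
      refine le_trans ?_ (hd u)
      unfold vertDegree
      rw [← Set.ncard_insert_of_notMem (a := v) (fun h => hvS h.2.2)]
      refine Set.ncard_le_ncard ?_ (Set.toFinite _)
      intro w hw
      rcases hw with rfl | hw
      · exact ((hmemN u).1 hu).1.symm
      · exact hw.1
    have hex : ∀ u, ∃ L : Finset ℕ, (∀ x ∈ L, x ∈ Finset.range (d + 1) ∧
        x ∉ palette (restr H S) c u) ∧ #L = if u = u0 then 1 else if u ∈ N then 2 else 0 := by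
      intro u
      by_cases hu : u ∈ N
      · have h1 := miss_card hc u d (hdeg u hu)
        obtain ⟨L, hL, hLc⟩ := Finset.exists_subset_card_eq
          (show (if u = u0 then 1 else if u ∈ N then 2 else 0) ≤
            #((Finset.range (d + 1)).filter (fun x => x ∉ palette (restr H S) c u)) by
              split_ifs <;> omega)
        exact ⟨L, fun x hx => by simpa using hL hx, hLc⟩
      · have : u ≠ u0 := by rintro rfl; exact hu hu0
        exact ⟨∅, by simp, by simp [this, hu]⟩
    choose M hM hMc using hex
    have hNK : #N ≤ #(Finset.range (d + 1)) := by
      rw [Finset.card_range]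
      refine le_trans ?_ (Nat.le_succ_of_le (hd v))
      unfold vertDegree
      rw [← Set.ncard_coe_finset]
      refine Set.ncard_le_ncard ?_ (Set.toFinite _)
      intro w hw
      exact ((hmemN w).1 hw).1
    obtain ⟨c', g, h1, h2, h3, h4⟩ := sdr _ _ c M N u0 rfl hc hM hNK hu0 hMc
    refine ⟨c', g, h1, fun e => ?_, fun u hu => ?_, h4⟩
    · exact Finset.mem_range.1 ((h2 e).2 (Finset.mem_range.2 (hcd e)))
    · exact ⟨Finset.mem_range.1 (h3 u hu).1, (h3 u hu).2⟩
  set g' : W → ℕ := fun u => if u ∈ N then g u else 0 with hg'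
  have hg'N : ∀ u ∈ N, g' u = g u := by
    intro u hu
    simp [hg', hu]
  have hsymm : ∀ x y : W, (if x = v then g' y else if y = v then g' x else c' s(x, y)) =
      (if y = v then g' x else if x = v then g' y else c' s(y, x)) := by
    intro x y
    rw [Sym2.eq_swap]
    split_ifs with h1 h2 <;> simp_all
  refine ⟨Sym2.lift ⟨fun x y => if x = v then g' y else if y = v then g' x else c' s(x, y),
    hsymm⟩, ?_, ?_⟩
  · apply proper_of_injOn
    intro x w w' hw hw' he
    simp only [Sym2.lift_mk] at he
    have hN1 : ∀ y, (restr H (insert v S)).Adj v y → y ∈ N := by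
      intro y hy
      rw [hmemN]
      refine ⟨hy.1, ?_⟩
      rcases Finset.mem_insert.1 hy.2.2 with h | h
      · exact absurd h.symm hy.1.ne
      · exact h
    have hS1 : ∀ y z, (restr H (insert v S)).Adj y z → y ≠ v → z ≠ v →
        (restr H S).Adj y z := by
      intro y z h hy hz
      exact ⟨h.1, Finset.mem_of_mem_insert_of_ne h.2.1 hy, Finset.mem_of_mem_insert_of_ne h.2.2 hz⟩
    have hbad : ∀ z, x ≠ v → z ≠ v → (restr H (insert v S)).Adj x v →
        (restr H (insert v S)).Adj x z → g' x ≠ c' s(x, z) := by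
      intro z hx hz hxv hxz h
      have hxN := hN1 x hxv.symm
      rw [hg'N x hxN] at h
      apply (hg x hxN).2
      rw [palette_eq_image]
      exact ⟨z, hS1 x z hxz hx hz, h.symm⟩
    by_cases hx : x = v
    · subst hx
      rw [if_pos rfl, if_pos rfl, hg'N w (hN1 w hw), hg'N w' (hN1 w' hw')] at he
      exact hinj (hN1 w hw) (hN1 w' hw') he
    · rw [if_neg hx, if_neg hx] at he
      by_cases h1 : w = v
      · by_cases h2 : w' = v
        · rw [h1, h2]
        · rw [if_pos h1, if_neg h2] at he
          exact absurd he (hbad w' hx h2 (h1 ▸ hw) hw')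
      · by_cases h2 : w' = v
        · rw [if_neg h1, if_pos h2] at he
          exact absurd he.symm (hbad w hx h1 (h2 ▸ hw') hw)
        · rw [if_neg h1, if_neg h2] at he
          exact proper_injOn hc' x (hS1 x w hw hx h1) (hS1 x w' hw' hx h2) he
  · intro e
    induction e with
    | _ x y =>
    have hb : ∀ u, g' u < d + 1 := by
      intro u
      simp only [hg']
      split_ifs with h
      · exact (hg u h).1
      · omega
    simp only [Sym2.lift_mk]
    split_ifs
    · exact hb _
    · exact hb _
    · exact hcd' _

/-- Vizing's theorem. -/
lemma vizing {W : Type*} [Fintype W] (H : SimpleGraph W) (d : ℕ)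
    (hd : ∀ v, vertDegree H v ≤ d) :
    ∃ c : Sym2 W → ℕ, IsProperEdgeColoring H c ∧ ∀ e, c e < d + 1 := by
  obtain ⟨c, h1, h2⟩ := vizing_aux H d hd Finset.univ
  have : restr H Finset.univ = H := by
    ext x y
    simp [restr]
  exact ⟨c, this ▸ h1, h2⟩

open scoped Classical in
lemma vertDegree_eq_degree {V : Type*} [Fintype V] (G : SimpleGraph V) (v : V) :
    vertDegree G v = G.degree v := by
  unfold vertDegree
  rw [Set.ncard_eq_toFinset_card']
  rfl

lemma vertDegree_boxProd {V W : Type*} [Fintype V] [Fintype W] (G : SimpleGraph V)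
    (H : SimpleGraph W) (x : V × W) :
    vertDegree (G □ H) x = vertDegree G x.1 + vertDegree H x.2 := by
  classical
  rw [vertDegree_eq_degree, vertDegree_eq_degree, vertDegree_eq_degree,
    SimpleGraph.degree_boxProd]

lemma vertDegree_deleteEdges_cov {V : Type*} [Fintype V] {G : SimpleGraph V} {M X : Set (Sym2 V)}
    (hM : IsPerfectMatchingSet G M) (hX : X ⊆ M) {v : V} {e : Sym2 V} (he : e ∈ X)
    (hv : v ∈ e) : vertDegree (G.deleteEdges X) v + 1 = vertDegree G v := by
  obtain ⟨w, rfl⟩ := hv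
  have hadj : G.Adj v w := hM.1 (hX he)
  have h : (G.deleteEdges X).neighborSet v = G.neighborSet v \ {w} := by
    ext y
    simp only [SimpleGraph.mem_neighborSet, SimpleGraph.deleteEdges_adj, Set.mem_sdiff,
      Set.mem_singleton_iff]
    constructor
    · rintro ⟨h1, h2⟩
      refine ⟨h1, ?_⟩
      rintro rfl
      exact h2 he
    · rintro ⟨h1, h2⟩
      refine ⟨h1, fun h3 => h2 ?_⟩
      have := (hM.2 v).unique ⟨hX h3, by simp⟩ ⟨hX he, by simp⟩
      exact Sym2.congr_right.mp this
  unfold vertDegree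
  rw [h]
  exact Set.ncard_sdiff_singleton_add_one hadj (Set.toFinite _)

lemma vertDegree_deleteEdges_uncov {V : Type*} {G : SimpleGraph V} {X : Set (Sym2 V)}
    {v : V} (hv : ∀ e ∈ X, v ∉ e) : vertDegree (G.deleteEdges X) v = vertDegree G v := by
  unfold vertDegree
  congr 1
  ext y
  simp only [SimpleGraph.mem_neighborSet, SimpleGraph.deleteEdges_adj]
  exact ⟨fun h => h.1, fun h => ⟨h, fun h' => hv _ h' (by simp)⟩⟩

lemma two_le_r {V : Type*} [Fintype V] {G' : SimpleGraph V} {r : ℕ} {M X : Set (Sym2 V)}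
    (hconn : G'.Connected) (hreg : IsRegularDeg G' r)
    (hM : IsPerfectMatchingSet G' M) (hXne : X.Nonempty) (hXM : X ⊂ M) : 2 ≤ r := by
  by_contra hr
  obtain ⟨e, he⟩ := hXne
  obtain ⟨m, hmM, hmX⟩ := Set.exists_of_ssubset hXM
  induction e with
  | _ v v' =>
  have hadj : G'.Adj v v' := hM.1 (hXM.1 he)
  have huniq : ∀ a b c, G'.Adj a b → G'.Adj a c → b = c := by
    intro a b c hb hc
    have h1 : (G'.neighborSet a).ncard ≤ 1 := by
      have := hreg a
      unfold vertDegree at this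
      omega
    exact (Set.ncard_le_one (Set.toFinite _)).1 h1 b hb c hc
  have hclosed : ∀ x y, G'.Adj x y → (x = v ∨ x = v') → (y = v ∨ y = v') := by
    rintro x y h (rfl | rfl)
    · exact Or.inr (huniq _ _ _ h hadj)
    · exact Or.inl (huniq _ _ _ h hadj.symm)
  have hall : ∀ y, y = v ∨ y = v' := by
    intro y
    obtain ⟨p⟩ := hconn.preconnected v y
    have : ∀ (a b : V) (p : G'.Walk a b), (a = v ∨ a = v') → (b = v ∨ b = v') := by
      intro a b p
      induction p with
      | nil => exact id
      | cons h _ ih => exact fun h' => ih (hclosed _ _ h h')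
    exact this v y p (Or.inl rfl)
  induction m with
  | _ a b =>
  apply hmX
  have h2 : s(a, b) = s(v, v') := by
    apply (hM.2 a).unique ⟨hmM, by simp⟩ ⟨hXM.1 he, ?_⟩
    rw [Sym2.mem_iff]
    exact hall a
  rw [h2]
  exact he

open scoped Classical in
lemma prod_coloring {V W : Type*} [Fintype W] {G : SimpleGraph V} {H : SimpleGraph W}
    {g : Sym2 V → ℕ} {h : Sym2 W → ℕ} {d : ℕ} (hg : IsProperEdgeColoring G g)
    (hh : IsProperEdgeColoring H h) (hhd : ∀ e, h e < d + 1) (hd : IsRegularDeg H d) :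
    ∃ F : Sym2 (V × W) → ℕ, IsProperEdgeColoring (G □ H) F ∧
      (∀ v v' w, G.Adj v v' →
        F s((v, w), (v', w)) < d + 1 ∨ F s((v, w), (v', w)) = d + g s(v, v')) ∧
      (∀ v w w', H.Adj w w' → F s((v, w), (v, w')) < d + 1) := by
  have hm : ∀ w, ∃ x, x < d + 1 ∧ x ∉ palette H h w := by
    intro w
    by_contra! hcon
    have h1 : (Finset.range (d + 1) : Set ℕ) ⊆ palette H h w := by
      intro x hx
      exact hcon x (by simpa using hx)
    have h2 := Set.ncard_le_ncard h1 (by rw [palette_eq_image]; exact Set.toFinite _)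
    rw [palette_ncard hh, hd w, Set.ncard_coe_finset, Finset.card_range] at h2
    omega
  choose m hmd hmp using hm
  set mm : Sym2 W → ℕ := Sym2.lift ⟨fun x y => max (m x) (m y), fun x y => max_comm _ _⟩ with hmm
  set F : Sym2 (V × W) → ℕ := fun e => if (e.map Prod.snd).IsDiag then
    (if g (e.map Prod.fst) = 0 then mm (e.map Prod.snd) else d + g (e.map Prod.fst))
    else h (e.map Prod.snd) with hF
  have F1 : ∀ v v' w, F s((v, w), (v', w)) =
      if g s(v, v') = 0 then m w else d + g s(v, v') := by
    intro v v' w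
    simp [hF, hmm]
  have F2 : ∀ v w w', H.Adj w w' → F s((v, w), (v, w')) = h s(w, w') := by
    intro v w w' hw
    simp [hF, hw.ne]
  have hmix : ∀ v v' w w', H.Adj w w' → F s((v, w), (v', w)) ≠ F s((v, w), (v, w')) := by
    intro v v' w w' hw
    rw [F1, F2 _ _ _ hw]
    split_ifs with h0
    · intro he
      apply hmp w
      rw [palette_eq_image]
      exact ⟨w', hw, he.symm⟩
    · have := hhd s(w, w')
      omega
  refine ⟨F, ?_, ?_, ?_⟩
  · apply proper_of_injOn
    rintro ⟨v, w⟩ ⟨v1, w1⟩ ⟨v2, w2⟩ h1 h2 he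
    rw [SimpleGraph.boxProd_adj] at h1 h2
    dsimp only at h1 h2
    rcases h1 with ⟨h1, rfl⟩ | ⟨h1, rfl⟩ <;> rcases h2 with ⟨h2, rfl⟩ | ⟨h2, rfl⟩
    · rw [F1, F1] at he
      have hgeq : g s(v, v1) = g s(v, v2) := by
        have := hmd w
        split_ifs at he <;> omega
      rw [proper_injOn hg v h1 h2 hgeq]
    · exact absurd he (hmix _ _ _ _ h2)
    · exact absurd he.symm (hmix _ _ _ _ h1)
    · rw [F2 _ _ _ h1, F2 _ _ _ h2] at he
      rw [proper_injOn hh w h1 h2 he]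
  · intro v v' w hv
    rw [F1]
    split_ifs
    · exact Or.inl (hmd w)
    · exact Or.inr rfl
  · intro v w w' hw
    rw [F2 _ _ _ hw]
    exact hhd _

open scoped Classical in
lemma matching_coloring {V : Type*} {G' : SimpleGraph V} {M X : Set (Sym2 V)} {f : Sym2 V → ℕ}
    {k : ℕ} (hM : IsPerfectMatchingSet G' M)
    (hf : IsProperEdgeColoring (G'.deleteEdges M) f)
    (hfk : ∀ e ∈ (G'.deleteEdges M).edgeSet, f e < k) :
    IsProperEdgeColoring (G'.deleteEdges X) (fun e => if e ∈ M then k else f e) := by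
  have hmem : ∀ e ∈ (G'.deleteEdges X).edgeSet, e ∉ M → e ∈ (G'.deleteEdges M).edgeSet := by
    intro e he heM
    rw [SimpleGraph.edgeSet_deleteEdges] at he ⊢
    exact ⟨he.1, heM⟩
  rintro e₁ h₁ e₂ h₂ hne ⟨v, hv1, hv2⟩
  dsimp only
  split_ifs with hm1 hm2 hm2
  · exact absurd ((hM.2 v).unique ⟨hm1, hv1⟩ ⟨hm2, hv2⟩) hne
  · exact (hfk e₂ (hmem e₂ h₂ hm2)).ne'
  · exact (hfk e₁ (hmem e₁ h₁ hm1)).ne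
  · exact hf e₁ (hmem e₁ h₁ hm1) e₂ (hmem e₂ h₂ hm2) hne ⟨v, hv1, hv2⟩

lemma palette_eq_range {V : Type*} {G : SimpleGraph V} {f : Sym2 V → ℕ}
    (hf : IsProperEdgeColoring G f) (v : V) (n : ℕ) (hdeg : vertDegree G v = n)
    (hb : ∀ w, G.Adj v w → f s(v, w) < n) : palette G f v = (Finset.range n : Set ℕ) := by
  apply Set.eq_of_subset_of_ncard_le
  · rw [palette_eq_image]
    rintro x ⟨w, hw, rfl⟩
    simpa using hb w hw
  · rw [palette_ncard hf, hdeg, Set.ncard_coe_finset, Finset.card_range]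
  · exact Set.toFinite _

end Aux

/-- If `H` is a finite connected regular simple graph and `G` is a
class 1 nearly regular graph, then `š(G □ H) = 2`. -/
theorem paletteIndex_boxProd_NRG {V W : Type*} [Fintype V] [Fintype W]
    (G : SimpleGraph V) (H : SimpleGraph W)
    (hHconn : H.Connected) (hHreg : ∃ r, IsRegularDeg H r) (hG : IsNRG G) :
    paletteIndex (G □ H) = 2 := by
  classical
  obtain ⟨d, hd⟩ := hHreg
  obtain ⟨G', r, M, X, hconn, hreg, -, -, hM, hcl, hXne, hXM, rfl⟩ := hG
  have hr := two_le_r hconn hreg hM hXne hXM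
  obtain ⟨w0⟩ := hHconn.nonempty
  obtain ⟨v0⟩ := hconn.nonempty
  -- degrees
  have hcov : ∀ v w, (∃ e ∈ X, v ∈ e) → vertDegree (G'.deleteEdges X □ H) (v, w) = d + r - 1 := by
    rintro v w ⟨e, he, hv⟩
    rw [vertDegree_boxProd]
    have h1 := vertDegree_deleteEdges_cov hM hXM.1 he hv
    have h2 := hreg v
    have h3 := hd w
    dsimp only
    omega
  have huncov : ∀ v w, (¬ ∃ e ∈ X, v ∈ e) →
      vertDegree (G'.deleteEdges X □ H) (v, w) = d + r := by
    intro v w hv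
    rw [vertDegree_boxProd]
    have h1 := vertDegree_deleteEdges_uncov (G := G') (X := X) (v := v)
      (fun e he hve => hv ⟨e, he, hve⟩)
    have h2 := hreg v
    have h3 := hd w
    dsimp only
    omega
  -- lower bound
  have hlow : ∀ F, IsProperEdgeColoring (G'.deleteEdges X □ H) F →
      2 ≤ numPalettes (G'.deleteEdges X □ H) F := by
    intro F hF
    obtain ⟨e, he⟩ := hXne
    obtain ⟨m, hmM, hmX⟩ := Set.exists_of_ssubset hXM
    obtain ⟨v1, hv1⟩ : ∃ v, v ∈ e := ⟨_, Sym2.out_fst_mem e⟩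
    obtain ⟨v2, hv2⟩ : ∃ v, v ∈ m := ⟨_, Sym2.out_fst_mem m⟩
    have h1 := hcov v1 w0 ⟨e, he, hv1⟩
    have h2 := huncov v2 w0 (by
      rintro ⟨e', he', hv'⟩
      have := (hM.2 v2).unique ⟨hXM.1 he', hv'⟩ ⟨hmM, hv2⟩
      exact hmX (this ▸ he'))
    unfold numPalettes
    have hlt : 1 < (Set.range (palette (G'.deleteEdges X □ H) F)).ncard := by
      rw [Set.one_lt_ncard (Set.toFinite _)]
      refine ⟨_, ⟨(v1, w0), rfl⟩, _, ⟨(v2, w0), rfl⟩, ?_⟩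
      intro heq
      have h3 := palette_ncard hF (v1, w0)
      rw [heq, palette_ncard hF, h1, h2] at h3
      omega
    omega
  -- coloring of `G' - M`
  have hdegM : ∀ v, vertDegree (G'.deleteEdges M) v = r - 1 := by
    intro v
    obtain ⟨e, ⟨he, hv⟩, -⟩ := hM.2 v
    have h1 := vertDegree_deleteEdges_cov hM (Set.Subset.refl M) he hv
    have h2 := hreg v
    omega
  obtain ⟨f, hf, hfk⟩ : ∃ f, IsProperEdgeColoring (G'.deleteEdges M) f ∧
      ∀ e ∈ (G'.deleteEdges M).edgeSet, f e < r - 1 := by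
    have hmax : maxDeg (G'.deleteEdges M) = r - 1 := by
      unfold maxDeg
      have : Set.range (vertDegree (G'.deleteEdges M)) = {r - 1} := by
        ext x
        constructor
        · rintro ⟨v, rfl⟩
          exact hdegM v
        · rintro rfl
          exact ⟨v0, hdegM v0⟩
      rw [this, csSup_singleton]
    have hci : chromIndex (G'.deleteEdges M) = r - 1 := hcl.trans hmax
    have hpos : 0 < chromIndex (G'.deleteEdges M) := by omega
    have := Nat.sInf_mem (Nat.nonempty_of_pos_sInf hpos)
    change chromIndex (G'.deleteEdges M) ∈ _ at this
    rwa [hci] at this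
  obtain ⟨h, hh, hhd⟩ := vizing H d (fun v => (hd v).le)
  have hg := matching_coloring (X := X) hM hf hfk
  obtain ⟨F, hF, hF1, hF2⟩ := prod_coloring hg hh hhd hd
  have hfedge : ∀ v v', (G'.deleteEdges X).Adj v v' → s(v, v') ∉ M → f s(v, v') < r - 1 := by
    intro v v' hadj hm
    apply hfk
    rw [SimpleGraph.mem_edgeSet, SimpleGraph.deleteEdges_adj]
    exact ⟨(SimpleGraph.deleteEdges_adj.1 hadj).1, hm⟩
  have hpal : Set.range (palette (G'.deleteEdges X □ H) F) ⊆
      {(Finset.range (d + r - 1) : Set ℕ), (Finset.range (d + r) : Set ℕ)} := by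
    rintro _ ⟨⟨v, w⟩, rfl⟩
    by_cases hv : ∃ e ∈ X, v ∈ e
    · left
      apply palette_eq_range hF _ _ (hcov v w hv)
      rintro ⟨v', w'⟩ hadj
      rw [SimpleGraph.boxProd_adj] at hadj
      dsimp only at hadj
      rcases hadj with ⟨h1, rfl⟩ | ⟨h1, rfl⟩
      · have hnm : s(v, v') ∉ M := by
          intro hm
          obtain ⟨e, he, hve⟩ := hv
          have := (hM.2 v).unique ⟨hm, by simp⟩ ⟨hXM.1 he, hve⟩
          rw [SimpleGraph.deleteEdges_adj] at h1
          exact h1.2 (this ▸ he)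
        have h2 := hF1 v v' w h1
        rw [if_neg hnm] at h2
        have h3 := hfedge v v' h1 hnm
        omega
      · have h2 := hF2 v w w' h1
        omega
    · right
      apply palette_eq_range hF _ _ (huncov v w hv)
      rintro ⟨v', w'⟩ hadj
      rw [SimpleGraph.boxProd_adj] at hadj
      dsimp only at hadj
      rcases hadj with ⟨h1, rfl⟩ | ⟨h1, rfl⟩
      · have h2 := hF1 v v' w h1
        have h3 := hfedge v v' h1
        split_ifs at h2 with hnm
        · omega
        · have := h3 hnm
          omega
      · have h2 := hF2 v w w' h1
        omega
  have hup : numPalettes (G'.deleteEdges X □ H) F ≤ 2 :=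
    (Set.ncard_le_ncard hpal (Set.toFinite _)).trans ((Set.ncard_insert_le _ _).trans (by simp))
  have heq : numPalettes (G'.deleteEdges X □ H) F = 2 := le_antisymm hup (hlow F hF)
  unfold paletteIndex
  apply le_antisymm
  · exact Nat.sInf_le ⟨F, hF, heq⟩
  · refine le_csInf (Set.nonempty_of_mem (x := 2) ⟨F, hF, heq⟩) ?_
    rintro n ⟨F', hF', rfl⟩
    exact hlow F' hF'
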